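/- Fix a2 > 0 and let q : [0,1] → ℝ be continuous. For s ∈ ℂ with s ≠ 0 and λ = s⁴, let χ22(·,λ) be the unique solution of a2⁴u'''' + qu = λu on [0,1] with χ22(1) = 0, χ22'(1) = -1, χ22''(1) = λ, χ22'''(1) = 0. Then for each k ∈ {0,1,2,3} there exist constants C > 0 and r₀ > 0 such that for all s ∈ ℂ with |s| ≥ r₀ and all x ∈ [0,1]: |∂ₓᵏ χ22(x, s⁴)| ≤ C·|s|^{k+2}·e^{|s|(1−x)/a2}. -/

import Mathlib

open Set

/-- `u` solves the fourth order equation `a^4 u'''' + q u = λ u` on `S` and is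
four times continuously differentiable there. -/
def SolvesODE (a : ℝ) (q : ℝ → ℝ) (lam : ℂ) (S : Set ℝ) (u : ℝ → ℂ) : Prop :=
  ContDiffOn ℝ 4 u S ∧
  ∀ x ∈ S, (a : ℂ) ^ 4 * iteratedDerivWithin 4 u S x + (q x : ℂ) * u x = lam * u x

/-- The iterated derivatives of a `C^n` function on a set of unique differentiability are derivatives
of one another. -/
lemma ContDiffOn.hasDerivWithinAt_iteratedDerivWithin {S : Set ℝ} {u : ℝ → ℂ} {n m : ℕ}
    (hu : ContDiffOn ℝ n u S) (hS : UniqueDiffOn ℝ S) (hm : m < n) {x : ℝ} (hx : x ∈ S) :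
    HasDerivWithinAt (iteratedDerivWithin m u S) (iteratedDerivWithin (m + 1) u S x) S x := by
  rw [iteratedDerivWithin_succ]
  exact (hu.differentiableOn_iteratedDerivWithin (by exact_mod_cast hm) hS x hx).hasDerivWithinAt

/-- Grönwall's inequality on `[0, 1]`, integrating backwards from the endpoint `1`. -/
lemma norm_le_exp_of_norm_deriv_le_backward {E : Type*} [NormedAddCommGroup E] [NormedSpace ℝ E]
    {v v' : ℝ → E} {K : ℝ}
    (hv : ∀ x ∈ Icc (0 : ℝ) 1, HasDerivWithinAt v (v' x) (Icc 0 1) x)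
    (hK : ∀ x ∈ Icc (0 : ℝ) 1, ‖v' x‖ ≤ K * ‖v x‖) {x : ℝ} (hx : x ∈ Icc (0 : ℝ) 1) :
    ‖v x‖ ≤ ‖v 1‖ * Real.exp (K * (1 - x)) := by
  have hmaps : MapsTo (fun t : ℝ => 1 - t) (Icc 0 1) (Icc 0 1) :=
    fun t ht => ⟨by linarith [ht.2], by linarith [ht.1]⟩
  have hd : ∀ t ∈ Icc (0 : ℝ) 1,
      HasDerivWithinAt (fun t => v (1 - t)) (-v' (1 - t)) (Icc 0 1) t := by
    intro t ht
    have h := (hv (1 - t) (hmaps ht)).scomp t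
      ((hasDerivAt_id t).const_sub (1 : ℝ)).hasDerivWithinAt hmaps
    simpa [Function.comp_def] using h
  have h := norm_le_gronwallBound_of_norm_deriv_right_le (f := fun t => v (1 - t))
    (f' := fun t => -v' (1 - t)) (δ := ‖v 1‖) (K := K) (ε := 0) (a := 0) (b := 1)
    (fun t ht => (hd t ht).continuousWithinAt)
    (fun t ht => (hd t (Ico_subset_Icc_self ht)).mono_of_mem_nhdsWithin
      (Icc_mem_nhdsGE_of_mem ht))
    (by simp)
    (fun t ht => by simpa using hK (1 - t) (hmaps (Ico_subset_Icc_self ht)))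
    (1 - x) (hmaps hx)
  simpa [gronwallBound_ε0] using h

/-- Growth estimate for solutions of the fourth order equation, in terms of the data at `1`: the
derivatives rescaled by powers of `c = ‖s‖ / a` grow at rate at most `c (1 + Q / ‖s‖ ^ 4)`. -/
lemma SolvesODE.norm_iteratedDerivWithin_le {a : ℝ} (ha : 0 < a) {q : ℝ → ℝ} {Q : ℝ}
    (hQ : ∀ x ∈ Icc (0 : ℝ) 1, ‖q x‖ ≤ Q) {s : ℂ} (hs : 0 < ‖s‖) {u : ℝ → ℂ}
    (hu : SolvesODE a q (s ^ 4) (Icc (0 : ℝ) 1) u) {B : ℝ}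
    (hB : ∀ i : Fin 4, ‖iteratedDerivWithin i u (Icc (0 : ℝ) 1) 1‖ ≤ B * (‖s‖ / a) ^ (i : ℕ))
    (k : Fin 4) {x : ℝ} (hx : x ∈ Icc (0 : ℝ) 1) :
    ‖iteratedDerivWithin k u (Icc (0 : ℝ) 1) x‖ ≤
      B * (‖s‖ / a) ^ (k : ℕ) * Real.exp (‖s‖ / a * (1 + Q / ‖s‖ ^ 4) * (1 - x)) := by
  set c : ℝ := ‖s‖ / a with hc_def
  have hc : 0 < c := div_pos hs ha
  have hQ0 : 0 ≤ Q := (norm_nonneg _).trans (hQ x hx)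
  set D : ℕ → ℝ → ℂ := fun i => iteratedDerivWithin i u (Icc (0 : ℝ) 1) with hD
  let v : ℝ → Fin 4 → ℂ := fun t i => (c ^ (i : ℕ))⁻¹ • D i t
  let v' : ℝ → Fin 4 → ℂ := fun t i => (c ^ (i : ℕ))⁻¹ • D (i + 1) t
  have hnorm : ∀ t i, ‖v t i‖ = (c ^ (i : ℕ))⁻¹ * ‖D i t‖ := fun t i => by
    rw [norm_smul, Real.norm_of_nonneg (by positivity)]
  have hv : ∀ t ∈ Icc (0 : ℝ) 1, HasDerivWithinAt v (v' t) (Icc 0 1) t := fun t ht =>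
    hasDerivWithinAt_pi.2 fun i => (ContDiffOn.hasDerivWithinAt_iteratedDerivWithin (n := 4)
      hu.1 (uniqueDiffOn_Icc zero_lt_one) i.2 ht).const_smul (c ^ (i : ℕ))⁻¹
  have hD4 : ∀ t ∈ Icc (0 : ℝ) 1, ‖D 4 t‖ ≤ c ^ 4 * (1 + Q / ‖s‖ ^ 4) * ‖D 0 t‖ := by
    intro t ht
    have h : (a : ℂ) ^ 4 * D 4 t = (s ^ 4 - q t) * D 0 t := by
      simp only [hD, iteratedDerivWithin_zero]
      linear_combination hu.2 t ht
    have h' := congrArg norm h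
    rw [norm_mul, norm_mul, norm_pow, Complex.norm_of_nonneg ha.le] at h'
    have hle : ‖s ^ 4 - (q t : ℂ)‖ ≤ ‖s‖ ^ 4 + Q := by
      refine (norm_sub_le _ _).trans ?_
      rw [norm_pow, Complex.norm_real]
      gcongr
      exact hQ t ht
    have hce : c ^ 4 * (1 + Q / ‖s‖ ^ 4) = (‖s‖ ^ 4 + Q) / a ^ 4 := by
      rw [hc_def]; field_simp
    rw [hce, div_mul_eq_mul_div, le_div_iff₀ (by positivity), mul_comm, h']
    gcongr
  have hK : ∀ t ∈ Icc (0 : ℝ) 1, ‖v' t‖ ≤ c * (1 + Q / ‖s‖ ^ 4) * ‖v t‖ := by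
    intro t ht
    refine (pi_norm_le_iff_of_nonneg (by positivity)).2 fun i => ?_
    have hv'i : ‖v' t i‖ = (c ^ (i : ℕ))⁻¹ * ‖D (i + 1) t‖ := by
      rw [norm_smul, Real.norm_of_nonneg (by positivity)]
    rw [hv'i]
    rcases Nat.lt_or_ge i 3 with hi | hi
    · have h := norm_le_pi_norm (v t) ⟨i + 1, by omega⟩
      rw [hnorm] at h
      calc (c ^ (i : ℕ))⁻¹ * ‖D (i + 1) t‖
          = c * 1 * ((c ^ ((i : ℕ) + 1))⁻¹ * ‖D (i + 1) t‖) := by field_simp; ring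
        _ ≤ c * (1 + Q / ‖s‖ ^ 4) * ‖v t‖ := by
          gcongr
          exact le_add_of_nonneg_right (by positivity)
    · have hi3 : (i : ℕ) = 3 := by omega
      have h := norm_le_pi_norm (v t) 0
      rw [hnorm] at h
      rw [hi3]
      calc (c ^ 3)⁻¹ * ‖D 4 t‖
          ≤ (c ^ 3)⁻¹ * (c ^ 4 * (1 + Q / ‖s‖ ^ 4) * ‖D 0 t‖) := by
            gcongr
            exact hD4 t ht
        _ = c * (1 + Q / ‖s‖ ^ 4) * ‖D 0 t‖ := by field_simp
        _ ≤ c * (1 + Q / ‖s‖ ^ 4) * ‖v t‖ := by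
          gcongr
          simpa using h
  have hB0 : 0 ≤ B := by simpa using (norm_nonneg _).trans (hB 0)
  have hv1 : ‖v 1‖ ≤ B := (pi_norm_le_iff_of_nonneg hB0).2 fun i => by
    rw [hnorm, inv_mul_le_iff₀ (by positivity), mul_comm]
    exact hB i
  have h := (norm_le_pi_norm (v x) k).trans (norm_le_exp_of_norm_deriv_le_backward hv hK hx)
  rw [hnorm, inv_mul_le_iff₀ (by positivity)] at h
  calc ‖D k x‖ ≤ _ := h
    _ ≤ c ^ (k : ℕ) * (B * Real.exp (c * (1 + Q / ‖s‖ ^ 4) * (1 - x))) := by gcongr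
    _ = _ := by ring

/-- Part of Lemma 4.3: growth of `χ22(·, s⁴)` (the solution on `[0,1]` with
eigenparameter-dependent initial data `(0,-1,λ,0)` at `1`) and its first
three derivatives. -/
theorem chi22_asymptotic_bound
    (a2 : ℝ) (ha2 : 0 < a2) (q : ℝ → ℝ)
    (hq : ContinuousOn q (Icc (0 : ℝ) 1)) :
    ∀ k : ℕ, k ≤ 3 →
      ∃ C > (0 : ℝ), ∃ r₀ > (0 : ℝ), ∀ s : ℂ, r₀ ≤ ‖s‖ →
        ∀ χ22 : ℝ → ℂ,
          SolvesODE a2 q (s ^ 4) (Icc (0 : ℝ) 1) χ22 →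
          χ22 1 = 0 →
          iteratedDerivWithin 1 χ22 (Icc (0 : ℝ) 1) 1 = -1 →
          iteratedDerivWithin 2 χ22 (Icc (0 : ℝ) 1) 1 = s ^ 4 →
          iteratedDerivWithin 3 χ22 (Icc (0 : ℝ) 1) 1 = 0 →
          ∀ x ∈ Icc (0 : ℝ) 1,
            ‖iteratedDerivWithin k χ22 (Icc (0 : ℝ) 1) x‖
              ≤ C * ‖s‖ ^ (k + 2) * Real.exp (‖s‖ * (1 - x) / a2) := by
  intro k hk
  obtain ⟨Q, hQ⟩ := isCompact_Icc.exists_bound_of_continuousOn hq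
  have hQ0 : 0 ≤ Q := (norm_nonneg _).trans (hQ 0 (by simp))
  refine ⟨(a2 + a2 ^ 2) / a2 ^ k * Real.exp (Q / a2), by positivity, 1, one_pos, ?_⟩
  intro s hs u hu h0 h1 h2 h3 x hx
  have hs0 : 0 < ‖s‖ := one_pos.trans_le hs
  have hB : ∀ i : Fin 4, ‖iteratedDerivWithin i u (Icc (0 : ℝ) 1) 1‖ ≤
      (a2 + a2 ^ 2) * ‖s‖ ^ 2 * (‖s‖ / a2) ^ (i : ℕ) := by
    intro i
    fin_cases i
    · simp only [iteratedDerivWithin_zero, h0, norm_zero]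
      positivity
    · simp only [h1, norm_neg, norm_one, pow_one]
      rw [show (a2 + a2 ^ 2) * ‖s‖ ^ 2 * (‖s‖ / a2) = (1 + a2) * ‖s‖ ^ 3 by field_simp]
      nlinarith [one_le_pow₀ hs (n := 3)]
    · simp only [h2, norm_pow]
      rw [show (a2 + a2 ^ 2) * ‖s‖ ^ 2 * (‖s‖ / a2) ^ 2 = ‖s‖ ^ 4 + ‖s‖ ^ 4 / a2 by field_simp; ring]
      exact le_add_of_nonneg_right (by positivity)
    · simp only [h3, norm_zero]
      positivity
  have hexp : ‖s‖ / a2 * (1 + Q / ‖s‖ ^ 4) * (1 - x) ≤ Q / a2 + ‖s‖ * (1 - x) / a2 := by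
    have hle : Q / a2 / ‖s‖ ^ 3 * (1 - x) ≤ Q / a2 :=
      (mul_le_of_le_one_right (by positivity) (by linarith [hx.1])).trans
        (div_le_self (by positivity) (one_le_pow₀ hs))
    calc ‖s‖ / a2 * (1 + Q / ‖s‖ ^ 4) * (1 - x)
        = Q / a2 / ‖s‖ ^ 3 * (1 - x) + ‖s‖ * (1 - x) / a2 := by field_simp; ring
      _ ≤ _ := by gcongr
  calc ‖iteratedDerivWithin k u (Icc (0 : ℝ) 1) x‖
      ≤ (a2 + a2 ^ 2) * ‖s‖ ^ 2 * (‖s‖ / a2) ^ k *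
          Real.exp (‖s‖ / a2 * (1 + Q / ‖s‖ ^ 4) * (1 - x)) :=
        hu.norm_iteratedDerivWithin_le ha2 hQ hs0 hB ⟨k, by omega⟩ hx
    _ ≤ (a2 + a2 ^ 2) * ‖s‖ ^ 2 * (‖s‖ / a2) ^ k *
          Real.exp (Q / a2 + ‖s‖ * (1 - x) / a2) := by gcongr
    _ = _ := by
        rw [Real.exp_add, div_pow, pow_add]
        ring
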